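/- Let k ≥ 7 be a natural number and let G be a finite simple graph with maximum degree at most k. Suppose G contains pairwise distinct vertices u, v_1, …, v_p, x_1, …, x_{p-1} with p ≥ 3 such that: every v_i (1 ≤ i ≤ p) is adjacent to u; v_1 has degree exactly 2 and its two neighbors are u and x_1; x_i v_{i+1} and v_{i+1} x_{i+1} are edges of G for all 1 ≤ i ≤ p−2, x_{p-1} v_p and v_p x_1 are edges of G (so that x_1, v_2, x_2, …, x_{p-1}, v_p form a cycle); and d(v_i) = 3 for all 2 ≤ i ≤ p. Let L be a list assignment on the vertices and edges of G with |L(x)| ≥ k + 1 for every vertex and every edge x. If the graph obtained from G by deleting the vertices v_1, …, v_p admits a proper L-total-coloring, then G admits a proper L-total-coloring. -/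

import Mathlib

/-- A proper `L`-total-coloring of `G`: every vertex gets a color from its list,
every edge of `G` gets a color from its list, adjacent vertices receive distinct
colors, distinct edges sharing an endpoint receive distinct colors, and every edge
receives a color distinct from the colors of both of its endpoints. -/
def IsProperTotalColoring {V : Type*} (G : SimpleGraph V)
    (Lv : V → Finset ℕ) (Le : Sym2 V → Finset ℕ)
    (cv : V → ℕ) (ce : Sym2 V → ℕ) : Prop :=
  (∀ v, cv v ∈ Lv v) ∧
  (∀ e ∈ G.edgeSet, ce e ∈ Le e) ∧
  (∀ x y, G.Adj x y → cv x ≠ cv y) ∧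
  (∀ e ∈ G.edgeSet, ∀ f ∈ G.edgeSet, e ≠ f → (∃ x, x ∈ e ∧ x ∈ f) → ce e ≠ ce f) ∧
  (∀ e ∈ G.edgeSet, ∀ x ∈ e, ce e ≠ cv x)

/-- The graph obtained from `G` by deleting the vertices in `S`
(keeping the same ambient vertex type, with deleted vertices isolated). -/
def deleteVertices {V : Type*} (G : SimpleGraph V) (S : Set V) : SimpleGraph V where
  Adj x y := G.Adj x y ∧ x ∉ S ∧ y ∉ S
  symm := by
    constructor
    intro x y h
    exact ⟨h.1.symm, h.2.2, h.2.1⟩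
  loopless := by
    constructor
    intro x h
    exact G.loopless.irrefl x h.1

section ListEdgeColoring

variable {E A B : Type*}

/-- Stable matchings exist: edges carry two endpoints `a e`, `b e` and are ranked at each of them
(smaller ranks are preferred). -/
theorem exists_stable_matching [DecidableEq E] (a : E → A) (b : E → B) (ra rb : E → ℕ)
    (S : Finset E)
    (ha : ∀ e ∈ S, ∀ f ∈ S, a e = a f → ra e = ra f → e = f)
    (hb : ∀ e ∈ S, ∀ f ∈ S, b e = b f → rb e = rb f → e = f) :
    ∃ M ⊆ S, (∀ e ∈ M, ∀ f ∈ M, e ≠ f → a e ≠ a f ∧ b e ≠ b f) ∧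
      ∀ e ∈ S, e ∉ M → ∃ f ∈ M, (a f = a e ∧ ra f < ra e) ∨ (b f = b e ∧ rb f < rb e) := by
  classical
  induction S using Finset.strongInduction with
  | H S ih =>
  by_cases hT : ∃ e ∈ S, ∃ f ∈ S, b e = b f ∧ rb e < rb f ∧
      ∀ g ∈ S, a g = a e → ra e ≤ ra g
  · obtain ⟨e, he, f, hf, hef, hlt, htop⟩ := hT
    obtain ⟨M, hMS, hM, hdom⟩ := ih (S.erase f) (Finset.erase_ssubset hf)
      (fun e he f hf => ha e (Finset.mem_of_mem_erase he) f (Finset.mem_of_mem_erase hf))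
      (fun e he f hf => hb e (Finset.mem_of_mem_erase he) f (Finset.mem_of_mem_erase hf))
    refine ⟨M, hMS.trans (Finset.erase_subset _ _), hM, fun g hg hgM => ?_⟩
    by_cases hgf : g = f
    · subst hgf
      by_cases heM : e ∈ M
      · exact ⟨e, heM, Or.inr ⟨hef, hlt⟩⟩
      · have hne : e ≠ g := by rintro rfl; exact lt_irrefl _ hlt
        obtain ⟨t, ht, h | h⟩ := hdom e (Finset.mem_erase.2 ⟨hne, he⟩) heM
        · exact absurd (htop t (Finset.mem_of_mem_erase (hMS ht)) h.1) (not_le.2 h.2)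
        · exact ⟨t, ht, Or.inr ⟨h.1.trans hef, h.2.trans hlt⟩⟩
    · exact hdom g (Finset.mem_erase.2 ⟨hgf, hg⟩) hgM
  · push Not at hT
    refine ⟨S.filter fun e => ∀ g ∈ S, a g = a e → ra e ≤ ra g, Finset.filter_subset _ _, ?_, ?_⟩
    · intro e he f hf hne
      rw [Finset.mem_filter] at he hf
      refine ⟨fun h => hne (ha e he.1 f hf.1 h
        (le_antisymm (he.2 f hf.1 h.symm) (hf.2 e he.1 h))), fun h => ?_⟩
      rcases lt_trichotomy (rb e) (rb f) with hlt | heq | hlt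
      · obtain ⟨g, hg, hga, hgr⟩ := hT e he.1 f hf.1 h hlt
        exact absurd (he.2 g hg hga) (not_le.2 hgr)
      · exact hne (hb e he.1 f hf.1 h heq)
      · obtain ⟨g, hg, hga, hgr⟩ := hT f hf.1 e he.1 h.symm hlt
        exact absurd (hf.2 g hg hga) (not_le.2 hgr)
    · intro e he _
      obtain ⟨f, hf, hmin⟩ := (S.filter fun g => a g = a e).exists_min_image ra
        ⟨e, Finset.mem_filter.2 ⟨he, rfl⟩⟩
      rw [Finset.mem_filter] at hf
      have hftop : f ∈ S.filter fun e => ∀ g ∈ S, a g = a e → ra e ≤ ra g :=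
        Finset.mem_filter.2 ⟨hf.1, fun g hg hga =>
          hmin g (Finset.mem_filter.2 ⟨hg, hga.trans hf.2⟩)⟩
      have hle : ra f ≤ ra e := hmin e (Finset.mem_filter.2 ⟨he, rfl⟩)
      refine ⟨f, hftop, Or.inl ⟨hf.2, lt_of_le_of_ne hle fun heq => ?_⟩⟩
      obtain rfl := ha f hf.1 e he hf.2 heq
      contradiction

/-- Galvin's list colouring argument: if every edge has more colours than there are edges
preferred to it at one of its endpoints, then the edges can be coloured from their lists. -/
theorem exists_list_edge_coloring_of_card_dominating_lt [DecidableEq E] [DecidableEq A]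
    [DecidableEq B] (a : E → A) (b : E → B) (ra rb : E → ℕ) (S : Finset E)
    (ha : ∀ e ∈ S, ∀ f ∈ S, a e = a f → ra e = ra f → e = f)
    (hb : ∀ e ∈ S, ∀ f ∈ S, b e = b f → rb e = rb f → e = f)
    (L : E → Finset ℕ)
    (hL : ∀ e ∈ S, (S.filter fun f =>
      (a f = a e ∧ ra f < ra e) ∨ (b f = b e ∧ rb f < rb e)).card < (L e).card) :
    ∃ c : E → ℕ, (∀ e ∈ S, c e ∈ L e) ∧
      ∀ e ∈ S, ∀ f ∈ S, e ≠ f → (a e = a f ∨ b e = b f) → c e ≠ c f := by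
  induction S using Finset.strongInduction generalizing L with
  | H S ih =>
  rcases S.eq_empty_or_nonempty with rfl | ⟨e₀, he₀⟩
  · exact ⟨fun _ => 0, by simp, by simp⟩
  obtain ⟨γ, hγ⟩ := Finset.card_pos.1 (Nat.zero_lt_of_lt (hL e₀ he₀))
  have hsub : S.filter (fun e => γ ∈ L e) ⊆ S := Finset.filter_subset _ _
  obtain ⟨M, hMS, hM, hdom⟩ := exists_stable_matching a b ra rb (S.filter fun e => γ ∈ L e)
    (fun e he f hf => ha e (hsub he) f (hsub hf)) (fun e he f hf => hb e (hsub he) f (hsub hf))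
  have hMne : M.Nonempty := by
    by_contra hne
    rw [Finset.not_nonempty_iff_eq_empty] at hne
    subst hne
    obtain ⟨f, hf, -⟩ := hdom e₀ (Finset.mem_filter.2 ⟨he₀, hγ⟩) (by simp)
    simp at hf
  have hMS' : M ⊆ S := hMS.trans hsub
  have hss : S \ M ⊆ S := Finset.sdiff_subset
  obtain ⟨c, hcL, hc⟩ := ih (S \ M) (Finset.sdiff_ssubset hMS' hMne)
    (fun e he f hf => ha e (hss he) f (hss hf)) (fun e he f hf => hb e (hss he) f (hss hf))
    (fun e => (L e).erase γ) (by
      intro e he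
      have heS := hss he
      have heM : e ∉ M := (Finset.mem_sdiff.1 he).2
      by_cases hγe : γ ∈ L e
      · obtain ⟨f, hf, hfe⟩ := hdom e (Finset.mem_filter.2 ⟨heS, hγe⟩) heM
        have hlt := hL e heS
        rw [Finset.card_erase_of_mem hγe]
        have : ((S \ M).filter fun f =>
            (a f = a e ∧ ra f < ra e) ∨ (b f = b e ∧ rb f < rb e)).card <
            (S.filter fun f =>
              (a f = a e ∧ ra f < ra e) ∨ (b f = b e ∧ rb f < rb e)).card := by
          apply Finset.card_lt_card
          rw [Finset.ssubset_iff_of_subset (Finset.filter_subset_filter _ hss)]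
          refine ⟨f, Finset.mem_filter.2 ⟨hMS' hf, hfe⟩, fun h => ?_⟩
          exact (Finset.mem_sdiff.1 (Finset.mem_filter.1 h).1).2 hf
        omega
      · rw [Finset.erase_eq_of_notMem hγe]
        exact (Finset.card_le_card (Finset.filter_subset_filter _ hss)).trans_lt (hL e heS))
  refine ⟨fun e => if e ∈ M then γ else c e, fun e he => ?_, fun e he f hf hne hadj => ?_⟩
  · by_cases heM : e ∈ M
    · simpa [heM] using (Finset.mem_filter.1 (hMS heM)).2
    · simpa [heM] using Finset.mem_of_mem_erase (hcL e (Finset.mem_sdiff.2 ⟨he, heM⟩))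
  · by_cases heM : e ∈ M <;> by_cases hfM : f ∈ M
    · have := hM e heM f hfM hne
      tauto
    · simpa [heM, hfM] using
        (Finset.ne_of_mem_erase (hcL f (Finset.mem_sdiff.2 ⟨hf, hfM⟩))).symm
    · simpa [heM, hfM] using Finset.ne_of_mem_erase (hcL e (Finset.mem_sdiff.2 ⟨he, heM⟩))
    · simpa [heM, hfM] using hc e (Finset.mem_sdiff.2 ⟨he, heM⟩) f
        (Finset.mem_sdiff.2 ⟨hf, hfM⟩) hne hadj

/-- List edge colouring when every list is larger than the sum of the ranks of the edge at its
two endpoints. -/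
theorem exists_list_edge_coloring_of_rank_add_rank_lt [DecidableEq E] [DecidableEq A]
    [DecidableEq B] (a : E → A) (b : E → B) (ra rb : E → ℕ) (S : Finset E)
    (ha : ∀ e ∈ S, ∀ f ∈ S, a e = a f → ra e = ra f → e = f)
    (hb : ∀ e ∈ S, ∀ f ∈ S, b e = b f → rb e = rb f → e = f)
    (L : E → Finset ℕ) (hL : ∀ e ∈ S, ra e + rb e < (L e).card) :
    ∃ c : E → ℕ, (∀ e ∈ S, c e ∈ L e) ∧
      ∀ e ∈ S, ∀ f ∈ S, e ≠ f → (a e = a f ∨ b e = b f) → c e ≠ c f := by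
  refine exists_list_edge_coloring_of_card_dominating_lt a b ra rb S ha hb L fun e he => ?_
  refine lt_of_le_of_lt ?_ (hL e he)
  rw [Finset.filter_or]
  refine (Finset.card_union_le _ _).trans (add_le_add ?_ ?_)
  · rw [← Finset.card_range (ra e)]
    refine Finset.card_le_card_of_injOn ra (fun f hf => ?_) fun f hf g hg h => ?_
    · simpa using (Finset.mem_filter.1 hf).2.2
    · rw [Finset.mem_coe, Finset.mem_filter] at hf hg
      exact ha f hf.1 g hg.1 (hf.2.1.trans hg.2.1.symm) h
  · rw [← Finset.card_range (rb e)]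
    refine Finset.card_le_card_of_injOn rb (fun f hf => ?_) fun f hf g hg h => ?_
    · simpa using (Finset.mem_filter.1 hf).2.2
    · rw [Finset.mem_coe, Finset.mem_filter] at hf hg
      exact hb f hf.1 g hg.1 (hf.2.1.trans hg.2.1.symm) h

end ListEdgeColoring

/-- Incidences of the configuration: `none` stands for the hub `u` and `some j` for `x j`. -/
def IsIncidence (q : ℕ) (i : Fin (q + 1)) : Option (Fin q) → Prop
  | none => True
  | some j => i.val = j.val ∨ i.val = j.val + 1 ∨ (j.val = 0 ∧ i.val = q)

/-- The rank of an edge of the configuration among the edges at its endpoint `v i`. -/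
def spokeRank (q : ℕ) : Fin (q + 1) × Option (Fin q) → ℕ
  | (i, none) => min i.val 2
  | (i, some j) =>
    if j.val = 0 then if i.val = 0 then 1 else if i.val = 1 then 2 else 0 else i.val - j.val

/-- The rank of an edge of the configuration among the edges at its endpoint `u` or `x j`. -/
def rimRank (q : ℕ) : Fin (q + 1) × Option (Fin q) → ℕ
  | (i, none) => q - i.val
  | (i, some j) =>
    if j.val = 0 then if i.val = 0 then 1 else if i.val = 1 then 0 else 2
    else 1 - (i.val - j.val)

theorem spokeRank_injOn {q : ℕ} (hq : 2 ≤ q) {i : Fin (q + 1)} {o o' : Option (Fin q)}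
    (ho : IsIncidence q i o) (ho' : IsIncidence q i o')
    (h : spokeRank q (i, o) = spokeRank q (i, o')) : o = o' := by
  rcases o with _ | j <;> rcases o' with _ | j' <;>
    simp only [IsIncidence, spokeRank, Option.some.injEq, Fin.ext_iff, reduceCtorEq] at * <;>
    grind

theorem rimRank_injOn {q : ℕ} {i i' : Fin (q + 1)} {o : Option (Fin q)}
    (ho : IsIncidence q i o) (ho' : IsIncidence q i' o)
    (h : rimRank q (i, o) = rimRank q (i', o)) : i = i' := by
  rcases o with _ | j <;> simp only [IsIncidence, rimRank, Fin.ext_iff] at * <;> grind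

open Classical in
theorem spokeRank_add_rimRank_lt {q : ℕ} (hq : 2 ≤ q) {i : Fin (q + 1)} {o : Option (Fin q)}
    (ho : IsIncidence q i o) :
    spokeRank q (i, o) + rimRank q (i, o) <
      (Finset.univ.filter fun i => IsIncidence q i o).card := by
  rcases o with _ | j
  · rw [Finset.filter_true_of_mem (p := fun i => IsIncidence q i none) fun _ _ => trivial,
      Finset.card_univ, Fintype.card_fin]
    simp only [spokeRank, rimRank]
    omega
  · by_cases hj : j.val = 0
    · have hsub : ({⟨0, by omega⟩, ⟨1, by omega⟩, ⟨q, by omega⟩} : Finset (Fin (q + 1))) ⊆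
          Finset.univ.filter fun i => IsIncidence q i (some j) := by
        intro t ht
        simp only [Finset.mem_insert, Finset.mem_singleton, Fin.ext_iff] at ht
        refine Finset.mem_filter.2 ⟨Finset.mem_univ _, ?_⟩
        simp only [IsIncidence]
        omega
      have hcard := Finset.card_le_card hsub
      rw [Finset.card_eq_three.2 ⟨_, _, _, by simp [Fin.ext_iff], by simp [Fin.ext_iff]; omega,
        by simp [Fin.ext_iff]; omega, rfl⟩] at hcard
      simp only [IsIncidence, spokeRank, rimRank] at *
      grind
    · have hsub : ({⟨j.val, by omega⟩, ⟨j.val + 1, by omega⟩} : Finset (Fin (q + 1))) ⊆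
          Finset.univ.filter fun i => IsIncidence q i (some j) := by
        intro t ht
        simp only [Finset.mem_insert, Finset.mem_singleton, Fin.ext_iff] at ht
        refine Finset.mem_filter.2 ⟨Finset.mem_univ _, ?_⟩
        simp only [IsIncidence]
        omega
      have hcard := Finset.card_le_card hsub
      rw [Finset.card_pair (by simp [Fin.ext_iff])] at hcard
      simp only [IsIncidence, spokeRank, rimRank] at *
      grind

/-- Extending a total colouring over an independent set of vertices of degree at most three,
given that every edge between `v i` and `w o` can be ranked at both ends so that the sum of the
ranks is less than the number of edges joining `w o` to the deleted vertices. -/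
theorem exists_isProperTotalColoring_of_ranks {V I O : Type*} [Fintype V] [DecidableEq V]
    [Fintype I] [DecidableEq I] [Fintype O] [DecidableEq O]
    (G : SimpleGraph V) [DecidableRel G.Adj] (k : ℕ) (hk : 6 ≤ k) (hΔ : ∀ w, G.degree w ≤ k)
    (v : I → V) (w : O → V) (hv : Function.Injective v) (hw : Function.Injective w)
    (hvw : ∀ i o, v i ≠ w o) (P : I → O → Prop) [∀ i o, Decidable (P i o)]
    (hadj : ∀ i y, G.Adj (v i) y ↔ ∃ o, P i o ∧ y = w o) (hdeg : ∀ i, G.degree (v i) ≤ 3)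
    (ra rb : I × O → ℕ)
    (hra : ∀ i o o', P i o → P i o' → ra (i, o) = ra (i, o') → o = o')
    (hrb : ∀ i i' o, P i o → P i' o → rb (i, o) = rb (i', o) → i = i')
    (hrank : ∀ i o, P i o →
      ra (i, o) + rb (i, o) < (Finset.univ.filter fun i => P i o).card)
    (Lv : V → Finset ℕ) (Le : Sym2 V → Finset ℕ)
    (hLv : ∀ w, k + 1 ≤ (Lv w).card)
    (hLe : ∀ e ∈ G.edgeSet, k + 1 ≤ (Le e).card)
    (h : ∃ cv ce, IsProperTotalColoring (deleteVertices G (Set.range v)) Lv Le cv ce) :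
    ∃ cv ce, IsProperTotalColoring G Lv Le cv ce := by
  classical
  obtain ⟨cv, ce, hcvL, hceL, hvv, hee, hev⟩ := h
  set H := deleteVertices G (Set.range v) with hH
  have hHG : ∀ y z, H.Adj y z ↔ G.Adj y z ∧ y ∉ Set.range v ∧ z ∉ Set.range v :=
    fun _ _ => Iff.rfl
  have hHv : ∀ e ∈ H.edgeSet, ∀ i, v i ∉ e := by
    intro e
    induction e using Sym2.ind with
    | _ y z =>
    intro he i hi
    rw [SimpleGraph.mem_edgeSet, hHG] at he
    rcases Sym2.mem_iff.1 hi with rfl | rfl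
    · exact he.2.1 ⟨i, rfl⟩
    · exact he.2.2 ⟨i, rfl⟩
  have hwv : ∀ o, w o ∉ Set.range v := by rintro o ⟨i, hi⟩; exact hvw i o hi
  -- the edges to be coloured, and the colours forbidden at their outer endpoints
  let edge : I × O → Sym2 V := fun p => s(v p.1, w p.2)
  have hedge : Function.Injective edge := by
    rintro ⟨i, o⟩ ⟨i', o'⟩ h
    rcases Sym2.eq_iff.1 h with h | h
    · exact Prod.ext (hv h.1) (hw h.2)
    · exact absurd h.1 (hvw i o')
  let S : Finset (I × O) := Finset.univ.filter fun p => P p.1 p.2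
  have hS : ∀ p, p ∈ S ↔ P p.1 p.2 := fun p => by simp [S]
  have hedgeG : ∀ p ∈ S, edge p ∈ G.edgeSet := fun p hp =>
    (hadj p.1 (w p.2)).2 ⟨p.2, (hS p).1 hp, rfl⟩
  have hcases : ∀ e ∈ G.edgeSet, e ∈ H.edgeSet ∨ ∃ p ∈ S, e = edge p := by
    intro e
    induction e using Sym2.ind with
    | _ y z =>
    intro he
    rw [SimpleGraph.mem_edgeSet] at he
    by_cases hy : y ∈ Set.range v
    · obtain ⟨i, rfl⟩ := hy
      obtain ⟨o, ho, rfl⟩ := (hadj i z).1 he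
      exact Or.inr ⟨(i, o), (hS _).2 ho, rfl⟩
    by_cases hz : z ∈ Set.range v
    · obtain ⟨i, rfl⟩ := hz
      obtain ⟨o, ho, rfl⟩ := (hadj i y).1 he.symm
      exact Or.inr ⟨(i, o), (hS _).2 ho, Sym2.eq_swap⟩
    · exact Or.inl ⟨he, hy, hz⟩
  let forb : O → Finset ℕ := fun o =>
    insert (cv (w o)) ((H.neighborFinset (w o)).image fun y => ce s(w o, y))
  have hforb : ∀ o, (forb o).card + (Finset.univ.filter fun i => P i o).card ≤ k + 1 := by
    intro o
    have hdisj : Disjoint (H.neighborFinset (w o))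
        ((Finset.univ.filter fun i => P i o).image v) := by
      rw [Finset.disjoint_left]
      intro y hy hy'
      obtain ⟨i, -, rfl⟩ := Finset.mem_image.1 hy'
      exact ((hHG _ _).1 ((H.mem_neighborFinset _ _).1 hy)).2.2 ⟨i, rfl⟩
    have hsub : H.neighborFinset (w o) ∪ (Finset.univ.filter fun i => P i o).image v ⊆
        G.neighborFinset (w o) := by
      intro y hy
      rw [SimpleGraph.mem_neighborFinset]
      rcases Finset.mem_union.1 hy with hy | hy
      · exact ((hHG _ _).1 ((H.mem_neighborFinset _ _).1 hy)).1
      · obtain ⟨i, hi, rfl⟩ := Finset.mem_image.1 hy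
        exact ((hadj i _).2 ⟨o, (Finset.mem_filter.1 hi).2, rfl⟩).symm
    have h1 := Finset.card_le_card hsub
    rw [Finset.card_union_of_disjoint hdisj, Finset.card_image_of_injective _ hv,
      SimpleGraph.card_neighborFinset_eq_degree G] at h1
    have h2 : (forb o).card ≤ (H.neighborFinset (w o)).card + 1 :=
      (Finset.card_insert_le _ _).trans (Nat.add_le_add_right Finset.card_image_le 1)
    have h3 := hΔ (w o)
    omega
  obtain ⟨c, hcL, hc⟩ := exists_list_edge_coloring_of_rank_add_rank_lt
    Prod.fst Prod.snd ra rb S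
    (by
      rintro ⟨i, o⟩ hp ⟨i', o'⟩ hp' (rfl : i = i') hr
      rw [hra i o o' ((hS _).1 hp) ((hS _).1 hp') hr])
    (by
      rintro ⟨i, o⟩ hp ⟨i', o'⟩ hp' (rfl : o = o') hr
      rw [hrb i i' o ((hS _).1 hp) ((hS _).1 hp') hr])
    (fun p => Le (edge p) \ forb p.2) (by
      rintro ⟨i, o⟩ hp
      have h1 := hrank i o ((hS _).1 hp)
      have h2 := hLe _ (hedgeG _ hp)
      have h3 := hforb o
      have h4 := Finset.le_card_sdiff (forb o) (Le (edge (i, o)))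
      simp only
      omega)
  have hcforb : ∀ p ∈ S, c p ∉ forb p.2 := fun p hp => (Finset.mem_sdiff.1 (hcL p hp)).2
  let ce' : Sym2 V → ℕ := Function.extend edge c ce
  have hce'S : ∀ p, ce' (edge p) = c p := fun p => hedge.extend_apply c ce p
  have hce'H : ∀ e ∈ H.edgeSet, ce' e = ce e := by
    intro e he
    refine Function.extend_apply' _ _ _ ?_
    rintro ⟨p, rfl⟩
    exact hHv _ he p.1 (Sym2.mem_mk_left _ _)
  -- the deleted vertices are coloured last
  have hg : ∀ i, ∃ γ ∈ Lv (v i), γ ∉ (G.neighborFinset (v i)).image cv ∪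
      (G.neighborFinset (v i)).image fun y => ce' s(v i, y) := by
    intro i
    by_contra! hcon
    have h1 := (Finset.card_le_card hcon).trans (Finset.card_union_le _ _)
    have h2 : ((G.neighborFinset (v i)).image cv).card ≤ G.degree (v i) := Finset.card_image_le
    have h3 : ((G.neighborFinset (v i)).image fun y => ce' s(v i, y)).card ≤ G.degree (v i) :=
      Finset.card_image_le
    have h4 := hdeg i
    have h5 := hLv (v i)
    omega
  choose g hgL hgn using hg
  have hgv : ∀ i o, P i o → g i ≠ cv (w o) := by
    intro i o ho heq
    refine hgn i (Finset.mem_union_left _ (Finset.mem_image.2 ⟨w o, ?_, heq.symm⟩))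
    exact (G.mem_neighborFinset _ _).2 ((hadj i _).2 ⟨o, ho, rfl⟩)
  have hge : ∀ p ∈ S, c p ≠ g p.1 := by
    intro p hp heq
    refine hgn p.1 (Finset.mem_union_right _ (Finset.mem_image.2 ⟨w p.2, ?_, ?_⟩))
    · exact (G.mem_neighborFinset _ _).2 ((hadj p.1 _).2 ⟨p.2, (hS p).1 hp, rfl⟩)
    · exact (hce'S p).trans heq
  let cv' : V → ℕ := Function.extend v g cv
  have hcv'v : ∀ i, cv' (v i) = g i := fun i => hv.extend_apply g cv i
  have hcv'n : ∀ y, y ∉ Set.range v → cv' y = cv y := fun y hy =>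
    Function.extend_apply' _ _ _ hy
  have hcross : ∀ p ∈ S, ∀ f ∈ H.edgeSet, (∃ y, y ∈ edge p ∧ y ∈ f) → c p ≠ ce f := by
    rintro p hp f hf ⟨y, hyp, hyf⟩ heq
    rcases Sym2.mem_iff.1 hyp with rfl | rfl
    · exact hHv f hf _ hyf
    · obtain ⟨z, rfl⟩ := Sym2.mem_iff_exists.1 hyf
      refine hcforb p hp (Finset.mem_insert_of_mem (Finset.mem_image.2 ⟨z, ?_, heq.symm⟩))
      exact (H.mem_neighborFinset _ _).2 hf
  refine ⟨cv', ce', fun y => ?_, fun e he => ?_, fun y z hyz => ?_,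
    fun e he f hf hne hsh => ?_, fun e he y hy => ?_⟩
  · by_cases hy : y ∈ Set.range v
    · obtain ⟨i, rfl⟩ := hy
      rw [hcv'v]
      exact hgL i
    · rw [hcv'n y hy]
      exact hcvL y
  · rcases hcases e he with he | ⟨p, hp, rfl⟩
    · rw [hce'H e he]
      exact hceL e he
    · rw [hce'S]
      exact (Finset.mem_sdiff.1 (hcL p hp)).1
  · by_cases hy : y ∈ Set.range v
    · obtain ⟨i, rfl⟩ := hy
      obtain ⟨o, ho, rfl⟩ := (hadj i z).1 hyz
      rw [hcv'v, hcv'n _ (hwv o)]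
      exact hgv i o ho
    by_cases hz : z ∈ Set.range v
    · obtain ⟨i, rfl⟩ := hz
      obtain ⟨o, ho, rfl⟩ := (hadj i y).1 hyz.symm
      rw [hcv'v, hcv'n _ (hwv o)]
      exact (hgv i o ho).symm
    · rw [hcv'n y hy, hcv'n z hz]
      exact hvv y z ⟨hyz, hy, hz⟩
  · rcases hcases e he with he | ⟨p, hp, rfl⟩ <;> rcases hcases f hf with hf | ⟨p', hp', rfl⟩
    · rw [hce'H e he, hce'H f hf]
      exact hee e he f hf hne hsh
    · rw [hce'H e he, hce'S]
      obtain ⟨y, hy, hy'⟩ := hsh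
      exact (hcross p' hp' e he ⟨y, hy', hy⟩).symm
    · rw [hce'H f hf, hce'S]
      exact hcross p hp f hf hsh
    · rw [hce'S, hce'S]
      refine hc p hp p' hp' (fun h => hne (h ▸ rfl)) ?_
      obtain ⟨y, hy, hy'⟩ := hsh
      rcases Sym2.mem_iff.1 hy with rfl | rfl <;> rcases Sym2.mem_iff.1 hy' with h | h
      · exact Or.inl (hv h)
      · exact absurd h (hvw _ _)
      · exact absurd h.symm (hvw _ _)
      · exact Or.inr (hw h)
  · rcases hcases e he with he | ⟨p, hp, rfl⟩
    · rw [hce'H e he, hcv'n y (by rintro ⟨i, rfl⟩; exact hHv e he i hy)]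
      exact hev e he y hy
    · rw [hce'S]
      rcases Sym2.mem_iff.1 hy with rfl | rfl
      · rw [hcv'v]
        exact hge p hp
      · rw [hcv'n _ (hwv _)]
        exact fun h => hcforb p hp (h ▸ Finset.mem_insert_self _ _)

/-- Here `p = q + 1 ≥ 3`: `v : Fin (q+1) → V` encodes the vertices `v_1, …, v_p`
and `x : Fin q → V` encodes the vertices `x_1, …, x_{p-1}` (zero-indexed).
The cycle `x_1, v_2, x_2, …, x_{p-1}, v_p` is given by the edges
`x_j v_{j+1}` (`hcyc1`), `v_{j+1} x_{j+1}` for `j ≤ p-2` (`hcyc2`),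
and `v_p x_1` (`hcyc3`). -/
theorem stmt_7 {V : Type*} [Fintype V] [DecidableEq V]
    (G : SimpleGraph V) [DecidableRel G.Adj]
    (k : ℕ) (hk : 7 ≤ k) (hΔ : ∀ w, G.degree w ≤ k)
    (q : ℕ) (hq : 2 ≤ q) (u : V) (v : Fin (q + 1) → V) (x : Fin q → V)
    (hv : Function.Injective v) (hx : Function.Injective x)
    (huv : ∀ i, u ≠ v i) (hux : ∀ i, u ≠ x i) (hvx : ∀ i j, v i ≠ x j)
    (hadju : ∀ i : Fin (q + 1), G.Adj u (v i))
    (hnbr : G.degree (v 0) = 2 ∧ (G.neighborSet (v 0) = {u, x ⟨0, by omega⟩}))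
    (hcyc1 : ∀ i : Fin q, G.Adj (x i) (v i.succ))
    (hcyc2 : ∀ i : Fin q, i ≠ ⟨0, by omega⟩ → G.Adj (v i.castSucc) (x i))
    (hcyc3 : G.Adj (v (Fin.last q)) (x ⟨0, by omega⟩))
    (hdeg : ∀ i : Fin (q + 1), i ≠ 0 → G.degree (v i) = 3)
    (Lv : V → Finset ℕ) (Le : Sym2 V → Finset ℕ)
    (hLv : ∀ w, k + 1 ≤ (Lv w).card)
    (hLe : ∀ e ∈ G.edgeSet, k + 1 ≤ (Le e).card)
    (h : ∃ cv ce, IsProperTotalColoring (deleteVertices G (Set.range v)) Lv Le cv ce) :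
    ∃ cv ce, IsProperTotalColoring G Lv Le cv ce := by
  classical
  let w : Option (Fin q) → V := fun o => o.elim u x
  have hw : Function.Injective w := by
    rintro (_ | j) (_ | j') h
    · rfl
    · exact absurd h (hux j')
    · exact absurd h.symm (hux j)
    · exact congrArg some (hx h)
  have hvw : ∀ i o, v i ≠ w o := by
    rintro i (_ | j)
    · exact (huv i).symm
    · exact hvx i j
  have hinc : ∀ i o, IsIncidence q i o → G.Adj (v i) (w o) := by
    rintro i (_ | j) ho
    · exact (hadju i).symm
    · rcases ho with h | h | ⟨h, h'⟩
      · obtain rfl : i = j.castSucc := Fin.ext h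
        by_cases hj : j = ⟨0, by omega⟩
        · have hj0 : j.castSucc = 0 := by rw [hj]; rfl
          rw [hj0, ← SimpleGraph.mem_neighborSet, hnbr.2, hj]
          exact Or.inr rfl
        · exact hcyc2 j hj
      · obtain rfl : i = j.succ := Fin.ext h
        exact (hcyc1 j).symm
      · obtain rfl : i = Fin.last q := Fin.ext h'
        rw [show j = ⟨0, by omega⟩ from Fin.ext h]
        exact hcyc3
  have hdeg3 : ∀ i, G.degree (v i) ≤ 3 := by
    intro i
    by_cases hi : i = 0
    · rw [hi, hnbr.1]
      omega
    · exact (hdeg i hi).le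
  refine exists_isProperTotalColoring_of_ranks G k (by omega) hΔ v w hv hw hvw (IsIncidence q)
    (fun i y => ⟨fun hy => ?_, ?_⟩) hdeg3 (spokeRank q) (rimRank q)
    (fun _ _ _ => spokeRank_injOn hq) (fun _ _ _ => rimRank_injOn)
    (fun i o ho => spokeRank_add_rimRank_lt hq ho) Lv Le hLv hLe h
  · by_cases hi : i = 0
    · subst hi
      change y ∈ G.neighborSet (v 0) at hy
      rw [hnbr.2] at hy
      rcases hy with rfl | rfl
      · exact ⟨none, trivial, rfl⟩
      · exact ⟨some ⟨0, by omega⟩, Or.inl rfl, rfl⟩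
    · have hi0 : i.val ≠ 0 := fun h => hi (Fin.ext h)
      have hilt := i.isLt
      -- the three neighbours of `v i` are `u`, `x (i - 1)` and `x i`, with `x q` read as `x 0`
      obtain ⟨j, j', hj, hj', hne⟩ : ∃ j j' : Fin q, IsIncidence q i (some j) ∧
          IsIncidence q i (some j') ∧ j ≠ j' := by
        by_cases hiq : i.val = q
        · refine ⟨⟨i.val - 1, by omega⟩, ⟨0, by omega⟩, ?_, ?_, ?_⟩ <;>
            simp only [IsIncidence, ne_eq, Fin.ext_iff, true_and] <;> omega
        · refine ⟨⟨i.val - 1, by omega⟩, ⟨i.val, by omega⟩, ?_, ?_, ?_⟩ <;>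
            simp only [IsIncidence, ne_eq, Fin.ext_iff, true_or] <;> omega
      have hsub : ({none, some j, some j'} : Finset (Option (Fin q))).image w ⊆
          G.neighborFinset (v i) := by
        intro z hz
        obtain ⟨o, ho, rfl⟩ := Finset.mem_image.1 hz
        rw [SimpleGraph.mem_neighborFinset]
        simp only [Finset.mem_insert, Finset.mem_singleton] at ho
        rcases ho with rfl | rfl | rfl
        exacts [hinc i _ trivial, hinc i _ hj, hinc i _ hj']
      have heq := Finset.eq_of_subset_of_card_le hsub (by
        rw [SimpleGraph.card_neighborFinset_eq_degree, Finset.card_image_of_injective _ hw,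
          Finset.card_eq_three.2 ⟨_, _, _, by simp, by simp, by simpa using hne, rfl⟩]
        exact hdeg3 i)
      rw [← SimpleGraph.mem_neighborFinset, ← heq] at hy
      obtain ⟨o, ho, rfl⟩ := Finset.mem_image.1 hy
      refine ⟨o, ?_, rfl⟩
      simp only [Finset.mem_insert, Finset.mem_singleton] at ho
      rcases ho with rfl | rfl | rfl
      exacts [trivial, hj, hj']
  · rintro ⟨o, ho, rfl⟩
    exact hinc i o ho
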